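/- Let n ≥ 3 be odd and let c : Fin n → Fin 2 be a bit string of odd parity (c_1 ⊕ ⋯ ⊕ c_n = 1), so that the constant strategy [c] does not saturate GYNI_n. Then there exist natural numbers a, b, d with a + b + d = n and b odd such that P_{[c]} − P_{[w]} lies in the real linear span of { P_u : u a strategy saturating GYNI_n }, where w is the bit string consisting of a zeros, followed by b ones, followed by d zeros. -/

import Mathlib

noncomputable section

/-- Cyclic successor on `Fin n`. -/
def cnext {n : ℕ} (i : Fin n) : Fin n := ⟨((i : ℕ) + 1) % n, Nat.mod_lt _ i.pos⟩

/-- The box of a local deterministic strategy `s`, as a vector indexed by pairs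
`(a, x)` of output and input bit strings: `P_s(a|x) = ∏_i [a_i = s_i(x_i)]`. -/
def stratBox {n : ℕ} (s : Fin n → Fin 2 → Fin 2) :
    (Fin n → Fin 2) × (Fin n → Fin 2) → ℝ :=
  fun ax => ∏ i, if ax.1 i = s i (ax.2 i) then 1 else 0

/-- Even parity of a bit string: `x₁ ⊕ ⋯ ⊕ x_n = 0`. -/
def parity0 {n : ℕ} (x : Fin n → Fin 2) : Prop := (∑ i, (x i : ℕ)) % 2 = 0

/-- A strategy `s` saturates the GYNI_n inequality (for odd `n`) iff there is a bit string
`x` of even parity with `x_{i+1} = s_i(x_i)` for all `i` (indices cyclic). -/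
def Saturates {n : ℕ} (s : Fin n → Fin 2 → Fin 2) : Prop :=
  ∃ x : Fin n → Fin 2, parity0 x ∧ ∀ i, x (cnext i) = s i (x i)

/-- The constant strategy associated to a bit string `c`. -/
def constStrat {n : ℕ} (c : Fin n → Fin 2) : Fin n → Fin 2 → Fin 2 := fun j _ => c j

open Finset Function

/-- The linear span of the saturating boxes. -/
def saturatingSpan (n : ℕ) : Submodule ℝ ((Fin n → Fin 2) × (Fin n → Fin 2) → ℝ) :=
  Submodule.span ℝ {v | ∃ u : Fin n → Fin 2 → Fin 2, Saturates u ∧ v = stratBox u}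

/-- Two strategies are equivalent if their boxes agree modulo the saturating ones. -/
def BoxEquiv {n : ℕ} (s t : Fin n → Fin 2 → Fin 2) : Prop :=
  stratBox s - stratBox t ∈ saturatingSpan n

lemma Saturates.stratBox_mem {n : ℕ} {s : Fin n → Fin 2 → Fin 2} (h : Saturates s) :
    stratBox s ∈ saturatingSpan n :=
  Submodule.subset_span ⟨s, h, rfl⟩

lemma BoxEquiv.refl {n : ℕ} (s : Fin n → Fin 2 → Fin 2) : BoxEquiv s s := by
  simp [BoxEquiv]

lemma BoxEquiv.symm {n : ℕ} {s t : Fin n → Fin 2 → Fin 2} (h : BoxEquiv s t) :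
    BoxEquiv t s := by
  simpa [BoxEquiv] using neg_mem h

lemma BoxEquiv.trans {n : ℕ} {s t u : Fin n → Fin 2 → Fin 2} (h : BoxEquiv s t)
    (h' : BoxEquiv t u) : BoxEquiv s u := by
  simpa [BoxEquiv] using add_mem h h'

lemma stratBox_update_add {n : ℕ} (s : Fin n → Fin 2 → Fin 2) (i : Fin n)
    (f g : Fin 2 → Fin 2) :
    stratBox (update s i f) + stratBox (update s i (fun z => f z + 1)) =
      stratBox (update s i g) + stratBox (update s i (fun z => g z + 1)) := by
  have key : ∀ (h : Fin 2 → Fin 2) (ax : (Fin n → Fin 2) × (Fin n → Fin 2)),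
      stratBox (update s i h) ax = (if ax.1 i = h (ax.2 i) then 1 else 0) *
        ∏ j ∈ univ.erase i, if ax.1 j = s j (ax.2 j) then (1 : ℝ) else 0 := by
    intro h ax
    rw [stratBox, ← mul_prod_erase univ _ (mem_univ i)]
    congr 1
    · simp
    · refine prod_congr rfl fun j hj => ?_
      rw [update_of_ne (ne_of_mem_erase hj)]
  have one : ∀ a b : Fin 2,
      (if a = b then (1 : ℝ) else 0) + (if a = b + 1 then 1 else 0) = 1 := by
    intro a b
    fin_cases a <;> fin_cases b <;> simp
  ext ax
  simp only [Pi.add_apply, key, ← add_mul, one]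

lemma boxEquiv_update {n : ℕ} (s : Fin n → Fin 2 → Fin 2) (i : Fin n) (f g : Fin 2 → Fin 2)
    (hf : Saturates (update s i (fun z => f z + 1)))
    (hg : Saturates (update s i (fun z => g z + 1))) :
    BoxEquiv (update s i f) (update s i g) := by
  have h := sub_mem hg.stratBox_mem hf.stratBox_mem
  have h' := stratBox_update_add s i f g
  rwa [BoxEquiv, sub_eq_sub_iff_add_eq_add.2 (h'.trans (add_comm _ _))]

lemma sum_val_update {n : ℕ} (x : Fin n → Fin 2) (i : Fin n) (y : Fin 2) :
    (∑ j, (update x i y j : ℕ)) + (x i : ℕ) = (∑ j, (x j : ℕ)) + (y : ℕ) := by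
  rw [← add_sum_erase univ _ (mem_univ i), ← add_sum_erase univ (fun j => (x j : ℕ)) (mem_univ i),
    update_self, sum_congr rfl fun j hj => by rw [update_of_ne (ne_of_mem_erase hj)]]
  ring

lemma val_add_one_add (y : Fin 2) : ((y + 1 : Fin 2) : ℕ) + (y : ℕ) = 1 := by
  fin_cases y <;> rfl

lemma sum_val_flip_mod_two {n : ℕ} (x : Fin n → Fin 2) (i : Fin n) :
    (∑ j, (update x i (x i + 1) j : ℕ)) % 2 = ((∑ j, (x j : ℕ)) + 1) % 2 := by
  have h := sum_val_update x i (x i + 1)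
  have h' := val_add_one_add (x i)
  omega

lemma parity0_compl {n : ℕ} (hodd : Odd n) {x : Fin n → Fin 2}
    (hx : (∑ i, (x i : ℕ)) % 2 = 1) : parity0 (fun j => x j + 1) := by
  have h : (∑ j, ((x j + 1 : Fin 2) : ℕ)) + ∑ j, (x j : ℕ) = n := by
    rw [← sum_add_distrib, sum_congr rfl fun j _ => val_add_one_add (x j)]
    simp
  have := Nat.odd_iff.1 hodd
  change (∑ j, ((x j + 1 : Fin 2) : ℕ)) % 2 = 0
  omega

lemma cnext_injective {n : ℕ} : Injective (cnext : Fin n → Fin n) := by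
  intro i j h
  have h := Nat.ModEq.add_right_cancel' 1 (congrArg Fin.val h : (i + 1 : ℕ) % n = (j + 1) % n)
  exact Fin.ext (h.eq_of_lt_of_lt i.2 j.2)

lemma cnext_ne {n : ℕ} (hn : 3 ≤ n) (i : Fin n) : cnext i ≠ i := by
  intro h
  have h : (i + 1 : ℕ) % n = i := congrArg Fin.val h
  have := i.2
  rcases (show (i : ℕ) + 1 < n ∨ (i : ℕ) + 1 = n by omega) with h' | h'
  · rw [Nat.mod_eq_of_lt h'] at h; omega
  · rw [h', Nat.mod_self] at h; omega

lemma cnext_cnext_ne {n : ℕ} (hn : 3 ≤ n) (i : Fin n) : cnext (cnext i) ≠ i := by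
  intro h
  have h : ((i + 1 : ℕ) % n + 1) % n = i := congrArg Fin.val h
  have := i.2
  rw [Nat.mod_add_mod] at h
  rcases (show (i : ℕ) + 1 + 1 < n ∨ n ≤ (i : ℕ) + 1 + 1 by omega) with h' | h'
  · rw [Nat.mod_eq_of_lt h'] at h; omega
  · rw [Nat.mod_eq_sub_mod h', Nat.mod_eq_of_lt (by omega)] at h; omega

lemma eq_univ_of_cnext_mem {n : ℕ} {G : Finset (Fin n)} (hG : G.Nonempty)
    (h : ∀ j ∈ G, cnext j ∈ G) : G = univ := by
  obtain ⟨j, hj⟩ := hG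
  have reach : ∀ t : ℕ, (⟨(j + t) % n, Nat.mod_lt _ j.pos⟩ : Fin n) ∈ G := by
    intro t
    induction t with
    | zero => simpa [Nat.mod_eq_of_lt j.2] using hj
    | succ t ih => simpa [cnext, Nat.add_assoc] using h _ ih
  refine eq_univ_iff_forall.2 fun k => ?_
  convert reach (k + (n - j)) using 1
  have hjk : (j : ℕ) + (k + (n - j)) = k + n := by have := j.2; omega
  ext
  simp [hjk, Nat.mod_eq_of_lt k.2]

lemma boxEquiv_update_of_const {n : ℕ} (hn : 3 ≤ n) {s : Fin n → Fin 2 → Fin 2}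
    {x : Fin n → Fin 2} (hx : (∑ i, (x i : ℕ)) % 2 = 1) (hs : ∀ j, x (cnext j) = s j (x j))
    {i : Fin n} {y : Fin 2} (hi : s (cnext i) = fun _ => y) {f : Fin 2 → Fin 2}
    (hf : f (x i) = s i (x i)) : BoxEquiv s (update s i f) := by
  have sat : ∀ g : Fin 2 → Fin 2, g (x i) = s i (x i) →
      Saturates (update s i (fun z => g z + 1)) := by
    intro g hg
    refine ⟨update x (cnext i) (x (cnext i) + 1), ?_, fun j => ?_⟩
    · have := sum_val_flip_mod_two x (cnext i)
      unfold parity0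
      omega
    · by_cases hj : j = i
      · subst hj
        rw [update_self, update_self, update_of_ne (cnext_ne hn j).symm, hg, hs]
      · rw [update_of_ne (cnext_injective.ne hj), update_of_ne hj, hs]
        by_cases hk : j = cnext i
        · subst hk; simp [hi]
        · rw [update_of_ne hk]
  have h := boxEquiv_update s i (s i) f (sat _ rfl) (sat _ hf)
  rwa [update_eq_self] at h

/-- The strategy with fixed point `x` that is bijective at the parties in `G`, and constant
at the others. -/
def gateStrat {n : ℕ} (x : Fin n → Fin 2) (G : Finset (Fin n)) : Fin n → Fin 2 → Fin 2 :=
  fun j z => if j ∈ G then z + x j + x (cnext j) else x (cnext j)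

lemma add_self_add (a b : Fin 2) : a + a + b = b := by
  revert a b; decide

lemma gateStrat_apply_self {n : ℕ} (x : Fin n → Fin 2) (G : Finset (Fin n)) (j : Fin n) :
    x (cnext j) = gateStrat x G j (x j) := by
  simp [gateStrat, add_self_add]

lemma update_gateStrat_const {n : ℕ} (x : Fin n → Fin 2) (G : Finset (Fin n)) (i : Fin n) :
    update (gateStrat x G) i (fun _ => x (cnext i)) = gateStrat x (G.erase i) := by
  funext j
  by_cases hj : j = i
  · subst hj; funext z; simp [gateStrat]
  · funext z; simp [gateStrat, hj]

lemma gateStrat_boxEquiv_const {n : ℕ} (hn : 3 ≤ n) {x : Fin n → Fin 2}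
    (hx : (∑ i, (x i : ℕ)) % 2 = 1) (G : Finset (Fin n)) (hG : G ≠ univ) :
    BoxEquiv (gateStrat x G) (constStrat (x ∘ cnext)) := by
  induction G using Finset.strongInduction with
  | H G ih =>
    rcases G.eq_empty_or_nonempty with rfl | hne
    · convert BoxEquiv.refl _ using 1
      funext j z
      simp [gateStrat, constStrat]
    · obtain ⟨j, hj, hj'⟩ : ∃ j ∈ G, cnext j ∉ G := by
        by_contra! h
        exact hG (eq_univ_of_cnext_mem hne h)
      have h := boxEquiv_update_of_const hn hx (gateStrat_apply_self x G) (i := j)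
        (y := x (cnext (cnext j))) (by funext z; simp [gateStrat, hj'])
        (f := fun _ => x (cnext j)) (gateStrat_apply_self x G j)
      rw [update_gateStrat_const] at h
      refine h.trans (ih _ (erase_ssubset hj) fun h' => ?_)
      exact notMem_erase j G (h' ▸ mem_univ j)

/-- The fixed-point-free strategy obtained from the all-bijective one with fixed point `x`
by negating the output of party `i`. -/
def twistStrat {n : ℕ} (x : Fin n → Fin 2) (i : Fin n) : Fin n → Fin 2 → Fin 2 :=
  update (gateStrat x univ) i (fun z => gateStrat x univ i z + 1)

lemma const_boxEquiv_twistStrat {n : ℕ} (hn : 3 ≤ n) (hodd : Odd n) {x : Fin n → Fin 2}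
    (hx : (∑ i, (x i : ℕ)) % 2 = 1) (i : Fin n) :
    BoxEquiv (constStrat (x ∘ cnext)) (twistStrat x i) := by
  have hfix : ∀ j, x (cnext j) + 1 = gateStrat x univ j (x j + 1) := by
    intro j
    simp only [gateStrat, mem_univ, if_true]
    generalize x j = a
    generalize x (cnext j) = b
    revert a b; decide
  refine (gateStrat_boxEquiv_const hn hx (univ.erase i)
    fun h => notMem_erase i univ (h.symm ▸ mem_univ i :)).symm.trans ?_
  rw [← update_gateStrat_const]
  refine boxEquiv_update _ i _ _ ⟨_, parity0_compl hodd hx, fun j => ?_⟩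
    ⟨_, parity0_compl hodd hx, fun j => ?_⟩
  · by_cases hj : j = i
    · subst hj; simp
    · rw [update_of_ne hj]; exact hfix j
  · have cancel : ∀ a : Fin 2, a + 1 + 1 = a := by decide
    by_cases hj : j = i
    · subst hj
      simp only [update_self, cancel]
      exact hfix j
    · rw [update_of_ne hj]; exact hfix j

/-- Flip the bits at `i` and `cnext i`. -/
def flipPair {n : ℕ} (c : Fin n → Fin 2) (i : Fin n) : Fin n → Fin 2 :=
  fun j => if j = i ∨ j = cnext i then c j + 1 else c j

lemma sum_val_flipPair {n : ℕ} (hn : 3 ≤ n) (c : Fin n → Fin 2) (i : Fin n) :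
    (∑ j, (flipPair c i j : ℕ)) % 2 = (∑ j, (c j : ℕ)) % 2 := by
  have h : flipPair c i = update (update c i (c i + 1)) (cnext i)
      (update c i (c i + 1) (cnext i) + 1) := by
    funext j
    have := cnext_ne hn i
    by_cases hj : j = i
    · subst hj; simp [flipPair, this.symm]
    · by_cases hj' : j = cnext i
      · subst hj'; simp [flipPair, this]
      · simp [flipPair, hj, hj']
  rw [h, sum_val_flip_mod_two]
  have := sum_val_flip_mod_two c i
  omega

lemma twistStrat_flipPair {n : ℕ} (hn : 3 ≤ n) (x : Fin n → Fin 2) (i : Fin n) :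
    twistStrat (flipPair x (cnext i)) (cnext (cnext i)) = twistStrat x i := by
  have h1 := cnext_ne hn i
  have h2 := cnext_ne hn (cnext i)
  have h3 := cnext_cnext_ne hn i
  have h4 := cnext_ne hn (cnext (cnext i))
  have h5 := cnext_cnext_ne hn (cnext i)
  funext j z
  by_cases hj : j = i
  · subst hj
    simp only [twistStrat, update_self, update_of_ne h3.symm, gateStrat, flipPair, mem_univ,
      h1.symm, h3.symm, if_true, or_false, true_or, if_false, add_assoc]
  · by_cases hj' : j = cnext (cnext i)
    · subst hj'
      simp only [twistStrat, update_self, update_of_ne h3, gateStrat, flipPair, mem_univ,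
        h4, h5, if_true, or_false, or_true, if_false]
      generalize x (cnext (cnext i)) = a
      generalize x (cnext (cnext (cnext i))) = b
      revert a b z; decide
    · rw [twistStrat, twistStrat, update_of_ne hj, update_of_ne hj']
      simp only [gateStrat, flipPair, mem_univ, if_true, hj', cnext_injective.eq_iff, hj,
        or_false, false_or]
      split_ifs
      · generalize x j = a
        generalize x (cnext j) = b
        revert a b z; decide
      · rfl

lemma constStrat_boxEquiv_flipPair {n : ℕ} (hn : 3 ≤ n) (hodd : Odd n) {c : Fin n → Fin 2}
    (hc : (∑ i, (c i : ℕ)) % 2 = 1) (i : Fin n) :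
    BoxEquiv (constStrat c) (constStrat (flipPair c i)) := by
  let e : Fin n ≃ Fin n :=
    Equiv.ofBijective cnext (Finite.injective_iff_bijective.1 cnext_injective)
  set x : Fin n → Fin 2 := c ∘ e.symm with hxdef
  have hxc : x ∘ cnext = c := by
    funext j
    exact congrArg c (e.symm_apply_apply j)
  have hx : (∑ i, (x i : ℕ)) % 2 = 1 := by
    rw [← hc]
    exact congrArg (· % 2) (Equiv.sum_comp e.symm fun j => (c j : ℕ))
  have hflip : flipPair x (cnext i) ∘ cnext = flipPair c i := by
    funext j
    simp [flipPair, cnext_injective.eq_iff, ← hxc]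
  have h := (const_boxEquiv_twistStrat hn hodd hx i).trans
    (twistStrat_flipPair hn x i ▸ (const_boxEquiv_twistStrat hn hodd
      ((sum_val_flipPair hn x (cnext i)).trans hx) (cnext (cnext i))).symm)
  rwa [hxc, hflip] at h

lemma exists_boxEquiv_initial_ones {n : ℕ} (hn : 3 ≤ n) (hodd : Odd n) {c : Fin n → Fin 2}
    (hc : (∑ i, (c i : ℕ)) % 2 = 1) (m : ℕ) (hm : m < n) :
    ∃ c' : Fin n → Fin 2, (∑ i, (c' i : ℕ)) % 2 = 1 ∧ (∀ j : Fin n, (j : ℕ) < m → c' j = 1) ∧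
      BoxEquiv (constStrat c) (constStrat c') := by
  induction m with
  | zero => exact ⟨c, hc, by simp, .refl _⟩
  | succ m ih =>
    obtain ⟨c', hc', hones, hequiv⟩ := ih (by omega)
    let i : Fin n := ⟨m, by omega⟩
    by_cases hi : c' i = 1
    · refine ⟨c', hc', fun j hj => ?_, hequiv⟩
      rcases Nat.lt_succ_iff_lt_or_eq.1 hj with h | h
      · exact hones j h
      · rwa [show j = i from Fin.ext h]
    · refine ⟨flipPair c' i, (sum_val_flipPair hn c' i).trans hc', fun j hj => ?_,
        hequiv.trans (constStrat_boxEquiv_flipPair hn hodd hc' i)⟩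
      have hnext : ((cnext i : Fin n) : ℕ) = m + 1 := Nat.mod_eq_of_lt hm
      have hj' : j ≠ cnext i := fun h => by rw [h, hnext] at hj; omega
      rcases Nat.lt_succ_iff_lt_or_eq.1 hj with h | h
      · have hji : j ≠ i := fun h' => by rw [h'] at h; exact lt_irrefl _ h
        simpa [flipPair, hj', hji] using hones j h
      · rw [show j = i from Fin.ext h]
        have : c' i = 0 := by revert hi; generalize c' i = a; revert a; decide
        simp [flipPair, this]

lemma constStrat_boxEquiv_ones {n : ℕ} (hn : 3 ≤ n) (hodd : Odd n) {c : Fin n → Fin 2}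
    (hc : (∑ i, (c i : ℕ)) % 2 = 1) : BoxEquiv (constStrat c) (constStrat fun _ => 1) := by
  obtain ⟨c', hc', hones, hequiv⟩ := exists_boxEquiv_initial_ones hn hodd hc (n - 1) (by omega)
  let l : Fin n := ⟨n - 1, by omega⟩
  have hupd : update c' l 1 = fun _ => 1 := by
    funext j
    by_cases hj : j = l
    · simp [hj]
    · have : (j : ℕ) ≠ n - 1 := fun h => hj (Fin.ext h)
      rw [update_of_ne hj, hones j (by omega)]
  have hsum := sum_val_update c' l 1
  have hl : c' l = 1 := by
    rw [hupd] at hsum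
    simp only [Fin.val_one, sum_const, card_univ, Fintype.card_fin, smul_eq_mul, mul_one] at hsum
    have := Nat.odd_iff.1 hodd
    apply Fin.ext
    simp only [Fin.val_one]
    omega
  rwa [← hupd, ← hl, update_eq_self]

/-- For odd `n ≥ 3` and a bit string `c` of odd parity (so `[c]` does not
saturate GYNI_n), there are `a + b + d = n` with `b` odd such that `P_{[c]} − P_{[w]}` lies
in the linear span of the saturating boxes, where `w` consists of `a` zeros, then `b` ones,
then `d` zeros. -/
theorem stmt18 {n : ℕ} (hn : 3 ≤ n) (hodd : Odd n)
    (c : Fin n → Fin 2) (hc : (∑ i, (c i : ℕ)) % 2 = 1) :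
    ∃ a b d : ℕ, a + b + d = n ∧ Odd b ∧
      stratBox (constStrat c) -
        stratBox (constStrat
          (fun i : Fin n => if a ≤ (i : ℕ) ∧ (i : ℕ) < a + b then 1 else 0)) ∈
        Submodule.span ℝ
          {v | ∃ u : Fin n → Fin 2 → Fin 2, Saturates u ∧ v = stratBox u} := by
  refine ⟨0, n, 0, by simp, hodd, ?_⟩
  have hw : (fun i : Fin n => if 0 ≤ (i : ℕ) ∧ (i : ℕ) < 0 + n then (1 : Fin 2) else 0) =
      fun _ => 1 := by
    funext i
    simp
  rw [hw]
  exact constStrat_boxEquiv_ones hn hodd hc
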